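/- Let Σ = {a, b} be a two-letter alphabet and w, v ∈ Σ⁺. The identity w = v holds in UT_2(𝕋) if and only if for every z ∈ Σ and every x ∈ ℝ, f_z^w(x, 1) = f_z^v(x, 1) and f_z^w(x, -1) = f_z^v(x, -1) (where the first argument is the value assigned to a and the second the value assigned to b). -/

import Mathlib

/-- The tropical (max-plus) semiring `𝕋 = ℝ ∪ {-∞}`, with `⊕ = max` and `⊗ = +`. -/
abbrev TT : Type := WithBot ℝ

/-- Tropical (max-plus) multiplication of square matrices over `𝕋`:
`(A ⊗ B) i j = max_k (A i k + B k j)`. -/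
def tmul {ι : Type} [Fintype ι] (A B : Matrix ι ι TT) : Matrix ι ι TT :=
  fun i j => Finset.univ.sup fun k => A i k + B k j

/-- The image of a word under the semigroup homomorphism from the free semigroup `Σ⁺`
to tropical matrices determined by the letter assignment `a` (junk value on the empty word). -/
def evalWord {ι σ : Type} [Fintype ι] (a : σ → Matrix ι ι TT) : List σ → Matrix ι ι TT
  | [] => fun _ _ => ⊥
  | h :: t => t.foldl (fun M s => tmul M (a s)) (a h)

/-- A tropical matrix is upper triangular if all entries strictly below the diagonal are `-∞`. -/
def IsUT {n : ℕ} (A : Matrix (Fin n) (Fin n) TT) : Prop :=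
  ∀ i j : Fin n, j < i → A i j = ⊥

/-- The tropical polynomial function `f_t^w` associated to a word `w` and letter `t`:
`f_t^w(x) = max` over (1-based) positions `i` of `w` carrying the letter `t` of
`∑_{s ∈ Σ} λ_s^w(i-1) ⬝ x_s`, where `λ_s^w(i-1)` counts occurrences of `s` among the first
`i-1` letters of `w`; the maximum over the empty set is `-∞`. -/
def fpoly {σ : Type} [Fintype σ] [DecidableEq σ] (w : List σ) (t : σ) (x : σ → ℝ) : TT :=
  (Finset.univ.filter (fun i : Fin w.length => w.get i = t)).sup
    (fun i => (((∑ s : σ, ((w.take i.val).count s : ℝ) * x s) : ℝ) : TT))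

open Filter Topology

section Evaluation

variable {ι σ : Type} [Fintype ι]

lemma evalWord_append_singleton (a : σ → Matrix ι ι TT) {w : List σ} (hw : w ≠ []) (s : σ) :
    evalWord a (w ++ [s]) = tmul (evalWord a w) (a s) := by
  cases w with
  | nil => exact absurd rfl hw
  | cons h t => simp [evalWord, List.foldl_append]

lemma evalWord_mono {a b : σ → Matrix ι ι TT} (hab : ∀ s i j, a s i j ≤ b s i j) (w : List σ)
    (i j : ι) : evalWord a w i j ≤ evalWord b w i j := by
  induction w using List.reverseRecOn generalizing i j with
  | nil => exact le_rfl
  | append_singleton w s ih =>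
    rcases eq_or_ne w [] with rfl | hw
    · exact hab s i j
    · rw [evalWord_append_singleton a hw, evalWord_append_singleton b hw]
      exact Finset.sup_mono_fun fun k _ => add_le_add (ih i k) (hab s k j)

/-- The sequence `f` is eventually below every real number exceeding `l`. -/
def LimsupLE (f : ℕ → TT) (l : TT) : Prop :=
  ∀ c : ℝ, l < (c : TT) → ∀ᶠ N in atTop, f N < (c : TT)

lemma exists_add_eq_of_add_lt {x y : TT} {c : ℝ} (h : x + y < (c : TT)) :
    ∃ c₁ c₂ : ℝ, x < (c₁ : TT) ∧ y < (c₂ : TT) ∧ c₁ + c₂ = c := by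
  induction x using WithBot.recBotCoe with
  | bot =>
    induction y using WithBot.recBotCoe with
    | bot => exact ⟨c, 0, WithBot.bot_lt_coe _, WithBot.bot_lt_coe _, by ring⟩
    | coe y =>
      exact ⟨c - (y + 1), y + 1, WithBot.bot_lt_coe _, WithBot.coe_lt_coe.2 (by linarith), by ring⟩
  | coe x =>
    induction y using WithBot.recBotCoe with
    | bot =>
      exact ⟨x + 1, c - (x + 1), WithBot.coe_lt_coe.2 (by linarith), WithBot.bot_lt_coe _, by ring⟩
    | coe y =>
      have h' : x + y < c := by exact_mod_cast h
      exact ⟨x + (c - x - y) / 2, y + (c - x - y) / 2, WithBot.coe_lt_coe.2 (by linarith),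
        WithBot.coe_lt_coe.2 (by linarith), by ring⟩

lemma LimsupLE.add {f g : ℕ → TT} {x y : TT} (hf : LimsupLE f x) (hg : LimsupLE g y) :
    LimsupLE (fun N => f N + g N) (x + y) := by
  intro c hc
  obtain ⟨c₁, c₂, h₁, h₂, rfl⟩ := exists_add_eq_of_add_lt hc
  filter_upwards [hf c₁ h₁, hg c₂ h₂] with N hN₁ hN₂
  rw [WithBot.coe_add]
  exact (add_le_add hN₁.le le_rfl).trans_lt
    (WithBot.add_lt_add_left WithBot.coe_ne_bot hN₂)

lemma LimsupLE.finsetSup {κ : Type} (s : Finset κ) {f : ℕ → κ → TT} {x : κ → TT}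
    (h : ∀ k ∈ s, LimsupLE (fun N => f N k) (x k)) :
    LimsupLE (fun N => s.sup (f N)) (s.sup x) := by
  intro c hc
  rw [Finset.sup_lt_iff (WithBot.bot_lt_coe c)] at hc
  simp only [Finset.sup_lt_iff (WithBot.bot_lt_coe c)]
  exact (Finset.eventually_all s).2 fun k hk => h k hk c (hc k hk)

lemma LimsupLE.evalWord {a : σ → Matrix ι ι TT} {b : ℕ → σ → Matrix ι ι TT}
    (h : ∀ s i j, LimsupLE (fun N => b N s i j) (a s i j)) (w : List σ) (i j : ι) :
    LimsupLE (fun N => evalWord (b N) w i j) (evalWord a w i j) := by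
  induction w using List.reverseRecOn generalizing i j with
  | nil => exact fun c hc => Eventually.of_forall fun _ => hc
  | append_singleton w s ih =>
    rcases eq_or_ne w [] with rfl | hw
    · exact h s i j
    · simp only [evalWord_append_singleton _ hw]
      exact LimsupLE.finsetSup _ fun k _ => (ih i k).add (h s k j)

lemma evalWord_le_of_limsupLE {a : σ → Matrix ι ι TT} {b : ℕ → σ → Matrix ι ι TT}
    (hab : ∀ N s i j, a s i j ≤ b N s i j)
    (h : ∀ s i j, LimsupLE (fun N => b N s i j) (a s i j)) {w v : List σ}
    (hwv : ∀ N, evalWord (b N) w = evalWord (b N) v) (i j : ι) :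
    evalWord a w i j ≤ evalWord a v i j := by
  have key : ∀ c : ℝ, evalWord a v i j < (c : TT) → evalWord a w i j < (c : TT) := by
    intro c hc
    obtain ⟨N, hN⟩ := (LimsupLE.evalWord h v i j c hc).exists
    exact (evalWord_mono (hab N) w i j).trans_lt (hwv N ▸ hN)
  by_contra! hlt
  induction hx : evalWord a w i j using WithBot.recBotCoe with
  | bot => simp [hx] at hlt
  | coe x => exact lt_irrefl _ (hx ▸ key x (hx ▸ hlt))

lemma limsupLE_unbotD_add (x : TT) {δ : ℕ → ℝ} (hδ : Tendsto δ atTop (𝓝 0)) :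
    LimsupLE (fun N => ((x.unbotD (-(N : ℝ)) + δ N : ℝ) : TT)) x := by
  intro c hc
  induction x using WithBot.recBotCoe with
  | bot =>
    have h : Tendsto (fun N : ℕ => -(N : ℝ) + δ N) atTop atBot :=
      (tendsto_neg_atTop_atBot.comp tendsto_natCast_atTop_atTop).atBot_add hδ
    filter_upwards [h.eventually_lt_atBot c] with N hN
    exact WithBot.coe_lt_coe.2 (by simpa using hN)
  | coe x =>
    have h : Tendsto (fun N : ℕ => x + δ N) atTop (𝓝 (x + 0)) := tendsto_const_nhds.add hδ
    have hc' : x + 0 < c := by simpa using hc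
    filter_upwards [h.eventually_lt_const hc'] with N hN
    exact WithBot.coe_lt_coe.2 (by simpa using hN)

lemma le_unbotD_add (x : TT) (y : ℝ) {δ : ℝ} (hδ : 0 ≤ δ) : x ≤ ((x.unbotD y + δ : ℝ) : TT) := by
  induction x using WithBot.recBotCoe with
  | bot => exact bot_le
  | coe x => exact WithBot.coe_le_coe.2 (by simpa using hδ)

end Evaluation

section Polynomial

variable {σ : Type} [Fintype σ] [DecidableEq σ]

/-- The value at `x` of the linear form whose coefficients are the letter counts of `w`. -/
def content (w : List σ) (x : σ → ℝ) : ℝ := ∑ s, (w.count s : ℝ) * x s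

@[simp] lemma content_nil (x : σ → ℝ) : content [] x = 0 := by simp [content]

lemma content_append_singleton (w : List σ) (s : σ) (x : σ → ℝ) :
    content (w ++ [s]) x = content w x + x s := by
  simp [content, List.count_append, List.count_singleton, add_mul, Finset.sum_add_distrib]

lemma content_sub (w : List σ) (x y : σ → ℝ) : content w (x - y) = content w x - content w y := by
  simp [content, mul_sub]

lemma content_nonneg (w : List σ) {x : σ → ℝ} (hx : 0 ≤ x) : 0 ≤ content w x :=
  Finset.sum_nonneg fun s _ => mul_nonneg (Nat.cast_nonneg _) (hx s)

lemma fpoly_nil (t : σ) (x : σ → ℝ) : fpoly [] t x = ⊥ := by simp [fpoly]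

lemma fpoly_le_iff (w : List σ) (t : σ) (x : σ → ℝ) (c : TT) :
    fpoly w t x ≤ c ↔ ∀ i : ℕ, w[i]? = some t → ((content (w.take i) x : ℝ) : TT) ≤ c := by
  simp only [fpoly, Finset.sup_le_iff, Finset.mem_filter, Finset.mem_univ, true_and, content]
  constructor
  · intro h i hi
    obtain ⟨hlt, hi⟩ := List.getElem?_eq_some_iff.1 hi
    exact h ⟨i, hlt⟩ hi
  · intro h i hi
    exact h i.1 (List.getElem?_eq_some_iff.2 ⟨i.2, hi⟩)

lemma fpoly_append_singleton (w : List σ) (s t : σ) (x : σ → ℝ) :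
    fpoly (w ++ [s]) t x = fpoly w t x ⊔ if t = s then ((content w x : ℝ) : TT) else ⊥ := by
  refine eq_of_forall_ge_iff fun c => ?_
  rw [sup_le_iff, fpoly_le_iff, fpoly_le_iff]
  constructor
  · intro h
    refine ⟨fun i hi => ?_, ?_⟩
    · obtain ⟨hlt, -⟩ := List.getElem?_eq_some_iff.1 hi
      simpa [List.take_append_of_le_length hlt.le] using
        h i (by rwa [List.getElem?_append_left hlt])
    · split_ifs with hts
      · simpa using h w.length (by simp [hts])
      · exact bot_le
  · rintro ⟨h₁, h₂⟩ i hi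
    rcases lt_trichotomy i w.length with hlt | rfl | hgt
    · rw [List.getElem?_append_left hlt] at hi
      simpa [List.take_append_of_le_length hlt.le] using h₁ i hi
    · have hts : s = t := by simpa using hi
      simpa [hts] using h₂
    · rw [List.getElem?_eq_none (by simp; omega)] at hi
      simp at hi

lemma fpoly_smul (w : List σ) (t : σ) (x : σ → ℝ) {c : ℝ} (hc : 0 ≤ c) :
    fpoly w t (c • x) = (fpoly w t x).map (c * ·) := by
  have hmono : Monotone (WithBot.map (c * ·) : TT → TT) :=
    WithBot.monotone_map_iff.2 fun _ _ h => mul_le_mul_of_nonneg_left h hc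
  unfold fpoly
  rw [Finset.apply_sup_eq_sup_comp_of_linearOrder _ hmono rfl]
  refine Finset.sup_congr rfl fun i _ => ?_
  simp only [Function.comp, WithBot.map_coe, Finset.mul_sum, Pi.smul_apply, smul_eq_mul]
  congr 1
  exact Finset.sum_congr rfl fun s _ => by ring

lemma fpoly_add_le (w : List σ) (t : σ) {x : σ → ℝ} (hx : 0 ≤ x) :
    fpoly w t x + (x t : TT) ≤ ((content w x : ℝ) : TT) := by
  induction w using List.reverseRecOn with
  | nil => simp [fpoly_nil]
  | append_singleton w s ih =>
    rw [fpoly_append_singleton, max_add, content_append_singleton]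
    refine sup_le (ih.trans (WithBot.coe_le_coe.2 (by have := hx s; simpa using this))) ?_
    split_ifs with hts
    · rw [hts, ← WithBot.coe_add]
    · simp

lemma count_mul_le_fpoly_add {w : List σ} {t : σ} (ht : t ∈ w) {x : σ → ℝ} (hx : 0 ≤ x) :
    ((w.count t * x t : ℝ) : TT) ≤ fpoly w t x + (x t : TT) := by
  induction w using List.reverseRecOn with
  | nil => simp at ht
  | append_singleton w s ih =>
    rw [fpoly_append_singleton, max_add]
    by_cases hts : t = s
    · subst hts
      refine le_sup_of_le_right ?_
      have h : (w.count t : ℝ) * x t ≤ content w x :=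
        Finset.single_le_sum (f := fun s => (w.count s : ℝ) * x s)
          (fun s _ => mul_nonneg (Nat.cast_nonneg _) (hx s)) (Finset.mem_univ t)
      rw [if_pos rfl, ← WithBot.coe_add, WithBot.coe_le_coe]
      simp only [List.count_append, List.count_singleton_self]
      push_cast
      linarith
    · refine le_sup_of_le_left ?_
      have hw : t ∈ w := by simpa [hts] using ht
      simpa [List.count_append, List.count_singleton, Ne.symm hts] using ih hw

lemma count_mul_le_content {w v : List σ} {t : σ} {x : σ → ℝ} (hx : 0 ≤ x)
    (h : fpoly w t x = fpoly v t x) : w.count t * x t ≤ content v x := by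
  by_cases ht : t ∈ w
  · have h₁ := count_mul_le_fpoly_add ht hx
    rw [h] at h₁
    exact WithBot.coe_le_coe.1 (h₁.trans (fpoly_add_le v t hx))
  · simpa [List.count_eq_zero_of_not_mem ht] using content_nonneg v hx

/-- The assignment of upper triangular `2 × 2` matrices with diagonals `(p s, r s)` and
upper right entries `q s`. -/
def upperTri (p : σ → ℝ) (q : σ → TT) (r : σ → ℝ) : σ → Matrix (Fin 2) (Fin 2) TT :=
  fun s => !![((p s : ℝ) : TT), q s; ⊥, ((r s : ℝ) : TT)]

lemma isUT_upperTri {σ : Type} (p : σ → ℝ) (q : σ → TT) (r : σ → ℝ) (s : σ) :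
    IsUT (upperTri p q r s) := by
  intro i j hij
  fin_cases i <;> fin_cases j <;> simp_all [upperTri]

lemma evalWord_upperTri (p : σ → ℝ) (q : σ → TT) (r : σ → ℝ) {w : List σ} (hw : w ≠ []) :
    evalWord (upperTri p q r) w =
      !![((content w p : ℝ) : TT),
          Finset.univ.sup fun t => q t + ((content w r - r t : ℝ) : TT) + fpoly w t (p - r);
        ⊥, ((content w r : ℝ) : TT)] := by
  have hsup : ∀ (w : List σ) (s : σ),
      (Finset.univ.sup fun t => q t + ((content (w ++ [s]) r - r t : ℝ) : TT)
        + fpoly (w ++ [s]) t (p - r)) =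
      (((content w p : ℝ) : TT) + q s) ⊔ ((Finset.univ.sup fun t =>
        q t + ((content w r - r t : ℝ) : TT) + fpoly w t (p - r)) + ((r s : ℝ) : TT)) := by
    intro w s
    rw [Finset.apply_sup_eq_sup_comp_of_linearOrder (fun y : TT => y + ((r s : ℝ) : TT))
      (fun _ _ h => add_le_add_left h _) (WithBot.bot_add _), sup_comm]
    simp only [fpoly_append_singleton, content_append_singleton, add_max,
      Function.comp_def]
    refine (Finset.sup_sup (f := fun t => _) (g := fun t => _)).trans ?_
    congr 1
    · refine Finset.sup_congr rfl fun t _ => ?_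
      have h : ((content w r + r s - r t : ℝ) : TT)
          = ((content w r - r t : ℝ) : TT) + ((r s : ℝ) : TT) := by
        rw [← WithBot.coe_add]; congr 1; ring
      rw [h]; abel
    · have h : (q s + ((content w r + r s - r s : ℝ) : TT)) + ((content w (p - r) : ℝ) : TT)
          = ((content w p : ℝ) : TT) + q s := by
        rw [add_assoc, ← WithBot.coe_add, content_sub, add_comm]; congr 2; ring
      refine le_antisymm (Finset.sup_le fun t _ => ?_) ?_
      · split_ifs with hts
        · rw [hts, h]
        · simp
      · refine le_trans (le_of_eq ?_) (Finset.le_sup (Finset.mem_univ s))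
        rw [if_pos rfl, h]
  induction w using List.reverseRecOn with
  | nil => exact absurd rfl hw
  | append_singleton w s ih =>
    rw [hsup]
    rcases eq_or_ne w [] with rfl | hne
    · ext i j
      fin_cases i <;> fin_cases j <;>
        simp [evalWord, upperTri, fpoly_nil, content, List.count_singleton]
    · rw [evalWord_append_singleton _ hne, ih hne]
      simp only [content_append_singleton]
      ext i j
      fin_cases i <;> fin_cases j <;> simp [tmul, upperTri, Fin.univ_succ]

lemma evalWord_upperTri_indicator (x : σ → ℝ) (t : σ) {w : List σ} (hw : w ≠ []) :
    evalWord (upperTri x (fun s => if s = t then 0 else ⊥) 0) w 0 1 = fpoly w t x := by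
  rw [evalWord_upperTri _ _ _ hw]
  refine le_antisymm (Finset.sup_le fun s _ => ?_) ?_
  · by_cases hs : s = t
    · simp [hs, content]
    · simp [hs]
  · refine le_trans (le_of_eq ?_) (Finset.le_sup (Finset.mem_univ t))
    simp [content]

end Polynomial

section TwoLetters

variable {w v : List (Fin 2)}

/-- The polynomials of `w` and `v` agree at all points `(x, 1)` and `(x, -1)`. -/
def AgreeOnLines (w v : List (Fin 2)) : Prop :=
  ∀ (z : Fin 2) (x : ℝ),
    fpoly w z (fun s => if s = 0 then x else 1) = fpoly v z (fun s => if s = 0 then x else 1)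
    ∧ fpoly w z (fun s => if s = 0 then x else -1)
        = fpoly v z (fun s => if s = 0 then x else -1)

lemma AgreeOnLines.symm (h : AgreeOnLines w v) : AgreeOnLines v w :=
  fun z x => ⟨(h z x).1.symm, (h z x).2.symm⟩

lemma AgreeOnLines.count_le (h : AgreeOnLines w v) (t : Fin 2) : w.count t ≤ v.count t := by
  have key : ∀ (t : Fin 2) (x : ℝ), 0 ≤ x →
      (w.count t : ℝ) * (if t = 0 then x else 1) ≤ v.count 0 * x + v.count 1 := by
    intro t x hx
    have hx' : (0 : Fin 2 → ℝ) ≤ fun s => if s = 0 then x else 1 := by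
      intro s
      dsimp
      split_ifs
      exacts [hx, zero_le_one]
    simpa [content, Fin.sum_univ_two] using count_mul_le_content hx' (h t x).1
  fin_cases t
  · by_contra! hlt
    have h₁ := key 0 (v.count 1 + 1) (by positivity)
    have h₂ : (v.count 0 : ℝ) + 1 ≤ w.count 0 := by exact_mod_cast hlt
    have h₃ : (0 : ℝ) ≤ v.count 1 := Nat.cast_nonneg _
    simp only [if_true] at h₁
    nlinarith
  · have h₁ := key 1 0 le_rfl
    simp only [one_ne_zero, if_false, mul_one, mul_zero, zero_add] at h₁
    exact_mod_cast h₁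

lemma AgreeOnLines.content_eq (h : AgreeOnLines w v) (x : Fin 2 → ℝ) :
    content w x = content v x := by
  simp only [content, fun s => le_antisymm (h.count_le s) (h.symm.count_le s)]

lemma AgreeOnLines.fpoly_eq (h : AgreeOnLines w v) (t : Fin 2) {x : Fin 2 → ℝ} (hx : x 1 ≠ 0) :
    fpoly w t x = fpoly v t x := by
  rcases hx.lt_or_gt with hneg | hpos
  · have hx' : x = (-x 1) • (fun s : Fin 2 => if s = 0 then x 0 / (-x 1) else -1) := by
      ext s
      fin_cases s
      · simp; field_simp
      · simp
    rw [hx', fpoly_smul _ _ _ (by linarith), fpoly_smul _ _ _ (by linarith), (h t _).2]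
  · have hx' : x = x 1 • (fun s : Fin 2 => if s = 0 then x 0 / x 1 else 1) := by
      ext s
      fin_cases s
      · simp; field_simp
      · simp
    rw [hx', fpoly_smul _ _ _ hpos.le, fpoly_smul _ _ _ hpos.le, (h t _).1]

lemma AgreeOnLines.evalWord_upperTri_eq (h : AgreeOnLines w v) (hw : w ≠ []) (hv : v ≠ [])
    {p r : Fin 2 → ℝ} (q : Fin 2 → TT) (hpr : p 1 ≠ r 1) :
    evalWord (upperTri p q r) w = evalWord (upperTri p q r) v := by
  have hne : (p - r) 1 ≠ 0 := sub_ne_zero.2 hpr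
  simp only [evalWord_upperTri p q r hw, evalWord_upperTri p q r hv, h.content_eq,
    fun t => h.fpoly_eq t hne]

lemma AgreeOnLines.evalWord_le (h : AgreeOnLines w v) (hw : w ≠ []) (hv : v ≠ [])
    {a : Fin 2 → Matrix (Fin 2) (Fin 2) TT} (ha : ∀ s, IsUT (a s)) (i j : Fin 2) :
    evalWord a w i j ≤ evalWord a v i j := by
  let δ : ℕ → Fin 2 → ℝ := fun N s =>
    if (a s 0 0).unbotD (-(N : ℝ)) = (a s 1 1).unbotD (-(N : ℝ)) then 1 / ((N : ℝ) + 1) else 0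
  have hδ₀ : ∀ N s, 0 ≤ δ N s := by
    intro N s
    dsimp only [δ]
    split_ifs
    exacts [by positivity, le_rfl]
  have hδ : ∀ s, Tendsto (fun N => δ N s) atTop (𝓝 0) := by
    intro s
    refine squeeze_zero (fun N => hδ₀ N s) (fun N => ?_) tendsto_one_div_add_atTop_nhds_zero_nat
    dsimp only [δ]
    split_ifs
    exacts [le_rfl, by positivity]
  let b : ℕ → Fin 2 → Matrix (Fin 2) (Fin 2) TT := fun N =>
    upperTri (fun s => (a s 0 0).unbotD (-(N : ℝ)) + δ N s) (fun s => a s 0 1)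
      (fun s => (a s 1 1).unbotD (-(N : ℝ)) + 0)
  have h₁₀ : ∀ s, a s 1 0 = ⊥ := fun s => ha s 1 0 (by decide)
  refine evalWord_le_of_limsupLE (b := b) (fun N s i j => ?_) (fun s i j => ?_) (fun N => ?_) i j
  · fin_cases i <;> fin_cases j
    · exact le_unbotD_add _ _ (hδ₀ N s)
    · exact le_rfl
    · exact (h₁₀ s).le
    · exact le_unbotD_add _ _ le_rfl
  · fin_cases i <;> fin_cases j
    · exact limsupLE_unbotD_add _ (hδ s)
    · exact fun c hc => Eventually.of_forall fun _ => hc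
    · exact fun c _ => Eventually.of_forall fun _ => WithBot.bot_lt_coe c
    · exact limsupLE_unbotD_add _ tendsto_const_nhds
  · refine h.evalWord_upperTri_eq hw hv _ ?_
    dsimp only [δ]
    split_ifs with heq
    · have : 0 < 1 / ((N : ℝ) + 1) := by positivity
      rw [heq]
      intro hcon
      linarith
    · simpa using heq

end TwoLetters

/-- For a two-letter alphabet `Σ = {a, b}` (encoded as `Fin 2`, with `a = 0`
and `b = 1`), the identity `w = v` holds in `UT_2(𝕋)` iff for every letter `z` and every
`x ∈ ℝ`, `f_z^w(x, 1) = f_z^v(x, 1)` and `f_z^w(x, -1) = f_z^v(x, -1)` (first argument the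
value of `a`, second the value of `b`). -/
theorem stmt_8 (w v : List (Fin 2)) (hw : w ≠ []) (hv : v ≠ []) :
    (∀ a : Fin 2 → Matrix (Fin 2) (Fin 2) TT, (∀ s, IsUT (a s)) →
      evalWord a w = evalWord a v)
    ↔ (∀ (z : Fin 2) (x : ℝ),
        fpoly w z (fun s => if s = 0 then x else 1) = fpoly v z (fun s => if s = 0 then x else 1)
        ∧ fpoly w z (fun s => if s = 0 then x else -1)
            = fpoly v z (fun s => if s = 0 then x else -1)) := by
  constructor
  · intro h z x
    have key : ∀ y : Fin 2 → ℝ, fpoly w z y = fpoly v z y := by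
      intro y
      rw [← evalWord_upperTri_indicator y z hw, ← evalWord_upperTri_indicator y z hv,
        h _ (isUT_upperTri _ _ _)]
    exact ⟨key _, key _⟩
  · intro h a ha
    have h' : AgreeOnLines w v := h
    ext i j
    exact le_antisymm (h'.evalWord_le hw hv ha i j) (h'.symm.evalWord_le hv hw ha i j)
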